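/- arXiv:0803.0461 — 2 statements merged into one kernel-verified Lean document; each statement's English description precedes it below -/
import Mathlib

section
/- Let R be a commutative Noetherian ring, 𝔞 ⊆ 𝔟 ideals of R, and N a finitely generated R-module. Suppose x₁,…,xₙ ∈ R are elements such that the radical of 𝔞 + (x₁,…,xₙ) equals the radical of 𝔟. If t is an integer such that H^i_𝔞(N) is Artinian for all i > t, then H^i_𝔟(N) is Artinian for all i > t + n. In particular q_𝔟(N) ≤ q_𝔞(N) + n. -/
/-!
STATEMENT 12: Let R be a commutative Noetherian ring, 𝔞 ⊆ 𝔟 ideals of R, and N a finitely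
generated R-module. Suppose x₁,…,xₙ ∈ R are such that rad(𝔞 + (x₁,…,xₙ)) = rad(𝔟). If t is an
integer such that H^i_𝔞(N) is Artinian for all i > t, then H^i_𝔟(N) is Artinian for all
i > t + n (in particular q_𝔟(N) ≤ q_𝔞(N) + n).
-/

open CategoryTheory Opposite

universe u

namespace CategoryTheory.ProjectiveResolution

variable {R : Type u} [CommRing R] {X Y : ModuleCat.{u} R}

/-- The morphism `P.complex.X n ⟶ Y` underlying a cycle of `Hom(P, Y)`. -/
noncomputable def cyclesToHom (P : ProjectiveResolution X) (Y : ModuleCat.{u} R) (n : ℕ) :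
    (P.complex.linearYonedaObj R Y).cycles n →ₗ[R] (P.complex.X n ⟶ Y) :=
  ((P.complex.linearYonedaObj R Y).iCycles n).hom

lemma d_comp_cyclesToHom (P : ProjectiveResolution X) (n : ℕ)
    (z : (P.complex.linearYonedaObj R Y).cycles n) :
    P.complex.d (n + 1) n ≫ P.cyclesToHom Y n z = 0 :=
  congr($((P.complex.linearYonedaObj R Y).iCycles_d n (n + 1)) z)

lemma cyclesToHom_injective (P : ProjectiveResolution X) (n : ℕ) :
    Function.Injective (P.cyclesToHom Y n) :=
  (ModuleCat.mono_iff_injective ((P.complex.linearYonedaObj R Y).iCycles n)).1 inferInstance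

lemma exists_cyclesToHom_eq (P : ProjectiveResolution X) (n : ℕ) (f : P.complex.X n ⟶ Y)
    (hf : P.complex.d (n + 1) n ≫ f = 0) : ∃ z, P.cyclesToHom Y n z = f := by
  let K := P.complex.linearYonedaObj R Y
  let k : ModuleCat.of R R ⟶ K.X n := ModuleCat.ofHom (LinearMap.toSpanSingleton R _ f)
  have hk : k ≫ K.d n (n + 1) = 0 := by
    ext
    change P.complex.d (n + 1) n ≫ ((1 : R) • f) = 0
    rw [one_smul, hf]
  refine ⟨K.liftCycles k (n + 1) (by simp) hk (1 : R), ?_⟩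
  refine (congr($(K.liftCycles_i k (n + 1) (by simp) hk) (1 : R))).trans ?_
  exact one_smul R f

/-- The class in `Abelian.Ext X Y n` of a cycle of `Hom(P, Y)`. -/
noncomputable def cyclesToExt (P : ProjectiveResolution X) (Y : ModuleCat.{u} R) (n : ℕ) :
    (P.complex.linearYonedaObj R Y).cycles n →ₗ[R] Abelian.Ext.{u} X Y n where
  toFun z := P.extMk (P.cyclesToHom Y n z) (n + 1) rfl (P.d_comp_cyclesToHom n z)
  map_add' z w := by
    rw [P.add_extMk]
    congr 1
    exact map_add _ _ _
  map_smul' r z := by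
    rw [RingHom.id_apply, Abelian.Ext.smul_eq_comp_mk₀, P.extMk_comp_mk₀]
    congr 1
    rw [map_smul, Linear.comp_smul, Category.comp_id]

lemma cyclesToExt_surjective (P : ProjectiveResolution X) (n : ℕ) :
    Function.Surjective (P.cyclesToExt Y n) := by
  intro α
  obtain ⟨f, hf, rfl⟩ := P.extMk_surjective α (n + 1) rfl
  obtain ⟨z, rfl⟩ := P.exists_cyclesToHom_eq n f hf
  exact ⟨z, rfl⟩

lemma ker_cyclesToExt (P : ProjectiveResolution X) (p : ℕ) :
    LinearMap.ker (P.cyclesToExt Y (p + 1)) =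
      LinearMap.ker ((P.complex.linearYonedaObj R Y).homologyπ (p + 1)).hom := by
  let K := P.complex.linearYonedaObj R Y
  ext z
  have hex : z ∈ LinearMap.ker (K.homologyπ (p + 1)).hom ↔
      ∃ g, K.toCycles p (p + 1) g = z := by
    have h := (ShortComplex.moduleCat_exact_iff_range_eq_ker _).1
      (ShortComplex.exact_of_g_is_cokernel
        (ShortComplex.mk _ _ (K.toCycles_comp_homologyπ p (p + 1)))
        (K.homologyIsCokernel p (p + 1) (by simp)))
    exact h ▸ LinearMap.mem_range
  refine (P.extMk_eq_zero_iff _ _ rfl (P.d_comp_cyclesToHom _ z) p rfl).trans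
    (Iff.trans ?_ hex.symm)
  have key : ∀ g : K.X p, P.cyclesToHom Y (p + 1) (K.toCycles p (p + 1) g) =
      P.complex.d (p + 1) p ≫ (show P.complex.X p ⟶ Y from g) := fun g =>
    congr($(K.toCycles_i p (p + 1)) g)
  constructor
  · rintro ⟨g, hg⟩
    exact ⟨g, P.cyclesToHom_injective _ ((key g).trans hg)⟩
  · rintro ⟨g, rfl⟩
    exact ⟨g, (key g).symm⟩

/-- The morphism of cochain complexes `Hom(P, Y) ⟶ Hom(P', Y)` induced by `P' ⟶ P`. -/
noncomputable def linearYonedaObjMap {X X' : ModuleCat.{u} R} {P : ProjectiveResolution X}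
    {P' : ProjectiveResolution X'} (Y : ModuleCat.{u} R) (φ : P'.complex ⟶ P.complex) :
    P.complex.linearYonedaObj R Y ⟶ P'.complex.linearYonedaObj R Y where
  f i := ((linearYoneda R _).obj Y).map (φ.f i).op
  comm' i j _ := by
    ext f
    change P'.complex.d j i ≫ φ.f i ≫ (show P.complex.X i ⟶ Y from f) =
      φ.f j ≫ P.complex.d j i ≫ (show P.complex.X i ⟶ Y from f)
    rw [φ.comm_assoc]

lemma isoExt_inv_naturality {X X' : ModuleCat.{u} R} {P : ProjectiveResolution X}
    {P' : ProjectiveResolution X'} (f : X' ⟶ X) (φ : P'.complex ⟶ P.complex)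
    (comm : φ.f 0 ≫ P.π.f 0 = P'.π.f 0 ≫ f) (Y : ModuleCat.{u} R) (n : ℕ) :
    (P.isoExt (R := R) n Y).inv ≫ ((Ext R (ModuleCat.{u} R) n).map f.op).app Y =
      HomologicalComplex.homologyMap (linearYonedaObjMap Y φ) n ≫
        (P'.isoExt (R := R) n Y).inv := by
  let F := ((linearYoneda R (ModuleCat.{u} R)).obj Y).rightOp
  have h1 := ProjectiveResolution.isoLeftDerivedObj_hom_naturality f P' P φ comm F n
  have h2 := HomologicalComplex.homologyOp_hom_naturality (linearYonedaObjMap Y φ) n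
  have h1' := congr(Quiver.Hom.unop $h1)
  have h2' := congr(Quiver.Hom.unop $h2)
  refine (Category.assoc ((P.complex.linearYonedaObj R Y).homologyOp n).hom.unop
    (P.isoLeftDerivedObj F n).hom.unop _).trans ?_
  refine (congr(((P.complex.linearYonedaObj R Y).homologyOp n).hom.unop ≫ $h1')).trans ?_
  refine (Category.assoc ((P.complex.linearYonedaObj R Y).homologyOp n).hom.unop _
    (P'.isoLeftDerivedObj F n).hom.unop).symm.trans ?_
  refine (congr($(h2'.symm) ≫ (P'.isoLeftDerivedObj F n).hom.unop)).symm.trans ?_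
  exact Category.assoc _ _ _

end CategoryTheory.ProjectiveResolution

namespace CategoryTheory.ProjectiveResolution

variable {R : Type u} [CommRing R] {X : ModuleCat.{u} R}

/-- The class of a cycle of `Hom(P, Y)` in the `Ext` module defined as a derived functor. -/
noncomputable def cyclesToDerivedExt (P : ProjectiveResolution X) (Y : ModuleCat.{u} R) (n : ℕ) :
    (P.complex.linearYonedaObj R Y).cycles n →ₗ[R]
      ((Ext R (ModuleCat.{u} R) n).obj (op X)).obj Y :=
  (P.isoExt (R := R) n Y).toLinearEquiv.symm.toLinearMap ∘ₗ
    ((P.complex.linearYonedaObj R Y).homologyπ n).hom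

lemma cyclesToDerivedExt_surjective (P : ProjectiveResolution X) (Y : ModuleCat.{u} R) (n : ℕ) :
    Function.Surjective (P.cyclesToDerivedExt Y n) :=
  (P.isoExt (R := R) n Y).toLinearEquiv.symm.surjective.comp
    ((ModuleCat.epi_iff_surjective ((P.complex.linearYonedaObj R Y).homologyπ n)).1 inferInstance)

lemma ker_cyclesToDerivedExt (P : ProjectiveResolution X) (Y : ModuleCat.{u} R) (n : ℕ) :
    LinearMap.ker (P.cyclesToDerivedExt Y n) =
      LinearMap.ker ((P.complex.linearYonedaObj R Y).homologyπ n).hom :=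
  LinearEquiv.ker_comp _ _

/-- The comparison, in positive degrees, of `Abelian.Ext` with the derived functor `Ext`. -/
noncomputable def extEquivDerivedExt (P : ProjectiveResolution X) (Y : ModuleCat.{u} R) (p : ℕ) :
    Abelian.Ext.{u} X Y (p + 1) ≃ₗ[R] ((Ext R (ModuleCat.{u} R) (p + 1)).obj (op X)).obj Y :=
  ((P.cyclesToExt Y (p + 1)).quotKerEquivOfSurjective (P.cyclesToExt_surjective _)).symm ≪≫ₗ
    Submodule.quotEquivOfEq _ _
      ((P.ker_cyclesToExt p).trans (P.ker_cyclesToDerivedExt Y (p + 1)).symm) ≪≫ₗ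
    (P.cyclesToDerivedExt Y (p + 1)).quotKerEquivOfSurjective
      (P.cyclesToDerivedExt_surjective _ _)

lemma extEquivDerivedExt_cyclesToExt (P : ProjectiveResolution X) (Y : ModuleCat.{u} R) (p : ℕ)
    (z : (P.complex.linearYonedaObj R Y).cycles (p + 1)) :
    P.extEquivDerivedExt Y p (P.cyclesToExt Y (p + 1) z) = P.cyclesToDerivedExt Y (p + 1) z := by
  have h : ((P.cyclesToExt Y (p + 1)).quotKerEquivOfSurjective (P.cyclesToExt_surjective _)).symm
      (P.cyclesToExt Y (p + 1) z) = Submodule.Quotient.mk z := by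
    rw [LinearEquiv.symm_apply_eq]
    rfl
  exact congr((P.cyclesToDerivedExt Y (p + 1)).quotKerEquivOfSurjective
    (P.cyclesToDerivedExt_surjective _ _) (Submodule.quotEquivOfEq _ _
      ((P.ker_cyclesToExt p).trans (P.ker_cyclesToDerivedExt Y (p + 1)).symm) $h))

lemma extEquivDerivedExt_naturality {X' : ModuleCat.{u} R} (P : ProjectiveResolution X)
    (P' : ProjectiveResolution X') (f : X' ⟶ X) (Y : ModuleCat.{u} R) (p : ℕ)
    (α : Abelian.Ext.{u} X Y (p + 1)) :
    ((Ext R (ModuleCat.{u} R) (p + 1)).map f.op).app Y (P.extEquivDerivedExt Y p α) =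
      P'.extEquivDerivedExt Y p ((Abelian.Ext.mk₀ f).comp α (zero_add _)) := by
  obtain ⟨z, rfl⟩ := P.cyclesToExt_surjective (Y := Y) (p + 1) α
  let φ := lift f P' P
  have comm : φ.f 0 ≫ P.π.f 0 = P'.π.f 0 ≫ f := lift_commutes_zero f P' P
  let K := P.complex.linearYonedaObj R Y
  let Φ := linearYonedaObjMap (P := P) (P' := P') Y φ
  have h1 : (Abelian.Ext.mk₀ f).comp (P.cyclesToExt Y (p + 1) z) (zero_add _) =
      P'.cyclesToExt Y (p + 1) (HomologicalComplex.cyclesMap Φ (p + 1) z) := by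
    refine (mk₀_comp_extMk (P.cyclesToHom Y (p + 1) z) (p + 1 + 1) rfl
      (P.d_comp_cyclesToHom _ z) (⟨φ, comm⟩ : Hom P' P f)).trans ?_
    have : P'.cyclesToHom Y (p + 1) (HomologicalComplex.cyclesMap Φ (p + 1) z) =
      φ.f (p + 1) ≫ P.cyclesToHom Y (p + 1) z :=
      congr($(HomologicalComplex.cyclesMap_i Φ (p + 1)) z)
    change _ = P'.extMk _ (p + 1 + 1) rfl (P'.d_comp_cyclesToHom _ _)
    congr 1
    exact this.symm
  rw [h1, extEquivDerivedExt_cyclesToExt, extEquivDerivedExt_cyclesToExt]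
  refine (congr($(isoExt_inv_naturality f φ comm Y (p + 1))
    (K.homologyπ (p + 1) z))).trans ?_
  exact congr((P'.isoExt (R := R) (p + 1) Y).inv
    ($(HomologicalComplex.homologyπ_naturality Φ (p + 1)) z))

end CategoryTheory.ProjectiveResolution

namespace localCohomology

variable {R : Type u} [CommRing R]

open Limits

/-- The projection `R ⧸ J ^ l ⟶ R ⧸ J ^ k` for `k ≤ l`. -/
noncomputable def quotientPowMap (J : Ideal R) {k l : ℕ} (h : k ≤ l) :
    ModuleCat.of R (R ⧸ J ^ l) ⟶ ModuleCat.of R (R ⧸ J ^ k) :=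
  ModuleCat.ofHom (Submodule.mapQ (J ^ l) (J ^ k) LinearMap.id (Ideal.pow_le_pow_right h))

/-- The structure map from `Ext i (R ⧸ J ^ k) N` to the colimit defining local cohomology. -/
noncomputable def ofDerivedExt (J : Ideal R) (i : ℕ) (N : ModuleCat.{u} R) (k : ℕ) :
    ((Ext R (ModuleCat.{u} R) i).obj (op (ModuleCat.of R (R ⧸ J ^ k)))).obj N ⟶
      (localCohomology J i).obj N :=
  have := hasColimitDiagram.{u, 0} (idealPowersDiagram J) i
  (colimit.ι (diagram (idealPowersDiagram J) i) (op (op k))).app N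

lemma ofDerivedExt_map (J : Ideal R) (i : ℕ) (N : ModuleCat.{u} R) {k l : ℕ} (h : k ≤ l)
    (e : ((Ext R (ModuleCat.{u} R) i).obj (op (ModuleCat.of R (R ⧸ J ^ k)))).obj N) :
    ofDerivedExt J i N l (((Ext R (ModuleCat.{u} R) i).map (quotientPowMap J h).op).app N e) =
      ofDerivedExt J i N k e := by
  have := hasColimitDiagram.{u, 0} (idealPowersDiagram J) i
  exact congr(($(colimit.w (diagram (idealPowersDiagram J) i)
    (homOfLE h).op.op)).app N e)

/-- Local cohomology, evaluated at a module, is a colimit of `Ext` modules. -/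
noncomputable def isColimitEvaluation (J : Ideal R) (i : ℕ) (N : ModuleCat.{u} R) :
    have := hasColimitDiagram.{u, 0} (idealPowersDiagram J) i
    IsColimit (((evaluation _ _).obj N).mapCocone
      (colimit.cocone (diagram (idealPowersDiagram J) i))) :=
  have := hasColimitDiagram.{u, 0} (idealPowersDiagram J) i
  isColimitOfPreserves _ (colimit.isColimit _)

instance preservesColimitsOfShape_forget :
    PreservesColimitsOfShape ℕᵒᵖᵒᵖ (forget (ModuleCat.{u} R)) :=
  have : PreservesFilteredColimitsOfSize.{0, 0} (forget (ModuleCat.{u} R)) :=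
    preservesFilteredColimitsOfSize_shrink.{0, u, 0, u} _
  have : IsFiltered ℕᵒᵖᵒᵖ := IsFiltered.of_equivalence (opOpEquivalence ℕ).symm
  inferInstance

lemma exists_ofDerivedExt_eq (J : Ideal R) (i : ℕ) (N : ModuleCat.{u} R)
    (y : (localCohomology J i).obj N) : ∃ k e, ofDerivedExt J i N k e = y := by
  obtain ⟨k, e, h⟩ := Concrete.isColimit_exists_rep _ (isColimitEvaluation J i N) y
  exact ⟨k.unop.unop, e, h⟩

lemma exists_map_eq_zero_of_ofDerivedExt_eq_zero (J : Ideal R) (i : ℕ) (N : ModuleCat.{u} R)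
    {k : ℕ} (e : ((Ext R (ModuleCat.{u} R) i).obj (op (ModuleCat.of R (R ⧸ J ^ k)))).obj N)
    (he : ofDerivedExt J i N k e = 0) :
    ∃ (l : ℕ) (h : k ≤ l),
      ((Ext R (ModuleCat.{u} R) i).map (quotientPowMap J h).op).app N e = 0 := by
  have : IsFiltered ℕᵒᵖᵒᵖ := IsFiltered.of_equivalence (opOpEquivalence ℕ).symm
  obtain ⟨l, f, g, h⟩ := Concrete.isColimit_exists_of_rep_eq _ (isColimitEvaluation J i N)
    (i := op (op k)) (j := op (op k)) e 0 (he.trans (map_zero (ofDerivedExt J i N k).hom).symm)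
  refine ⟨l.unop.unop, leOfHom f.unop.unop, ?_⟩
  refine Eq.trans ?_ (h.trans (map_zero _))
  rfl

/-- The structure map to local cohomology, with `Abelian.Ext` in place of the derived one. -/
noncomputable def ofExt (J : Ideal R) (p : ℕ) (N : ModuleCat.{u} R) (k : ℕ) :
    Abelian.Ext.{u} (ModuleCat.of R (R ⧸ J ^ k)) N (p + 1) →ₗ[R]
      (localCohomology J (p + 1)).obj N :=
  (ofDerivedExt J (p + 1) N k).hom ∘ₗ
    ((projectiveResolution _).extEquivDerivedExt N p).toLinearMap

lemma ofExt_comp (J : Ideal R) (p : ℕ) (N : ModuleCat.{u} R) {k l : ℕ} (h : k ≤ l)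
    (α : Abelian.Ext.{u} (ModuleCat.of R (R ⧸ J ^ k)) N (p + 1)) :
    ofExt J p N l ((Abelian.Ext.mk₀ (quotientPowMap J h)).comp α (zero_add _)) =
      ofExt J p N k α := by
  refine Eq.trans ?_ (ofDerivedExt_map J (p + 1) N h _)
  exact congr(ofDerivedExt J (p + 1) N l
    $(ProjectiveResolution.extEquivDerivedExt_naturality _ _ (quotientPowMap J h) N p α)).symm

lemma exists_ofExt_eq (J : Ideal R) (p : ℕ) (N : ModuleCat.{u} R)
    (y : (localCohomology J (p + 1)).obj N) : ∃ k α, ofExt J p N k α = y := by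
  obtain ⟨k, e, rfl⟩ := exists_ofDerivedExt_eq J (p + 1) N y
  obtain ⟨α, rfl⟩ := ((projectiveResolution _).extEquivDerivedExt N p).surjective e
  exact ⟨k, α, rfl⟩

lemma exists_comp_eq_zero_of_ofExt_eq_zero (J : Ideal R) (p : ℕ) (N : ModuleCat.{u} R) {k : ℕ}
    (α : Abelian.Ext.{u} (ModuleCat.of R (R ⧸ J ^ k)) N (p + 1)) (hα : ofExt J p N k α = 0) :
    ∃ (l : ℕ) (h : k ≤ l),
      (Abelian.Ext.mk₀ (quotientPowMap J h)).comp α (zero_add _) = 0 := by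
  obtain ⟨l, h, hl⟩ := exists_map_eq_zero_of_ofDerivedExt_eq_zero J (p + 1) N _ hα
  refine ⟨l, h, ((projectiveResolution _).extEquivDerivedExt N p).injective ?_⟩
  rw [map_zero, ← hl]
  exact (ProjectiveResolution.extEquivDerivedExt_naturality _ _ (quotientPowMap J h) N p α).symm

end localCohomology

/-- The submodule of elements of `M` annihilated by some power of the ideal `J`. -/
def Ideal.powTorsion {R : Type*} [CommRing R] (J : Ideal R) (M : Type*) [AddCommGroup M]
    [Module R M] : Submodule R M where
  carrier := {z | ∃ k : ℕ, ∀ r ∈ J ^ k, r • z = 0}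
  zero_mem' := ⟨0, fun r _ => smul_zero r⟩
  add_mem' := by
    rintro z w ⟨k, hk⟩ ⟨l, hl⟩
    refine ⟨max k l, fun r hr => ?_⟩
    rw [smul_add, hk r (Ideal.pow_le_pow_right (le_max_left k l) hr),
      hl r (Ideal.pow_le_pow_right (le_max_right k l) hr), add_zero]
  smul_mem' := by
    rintro s z ⟨k, hk⟩
    exact ⟨k, fun r hr => by rw [smul_comm, hk r hr, smul_zero]⟩

lemma Ideal.map_mem_powTorsion {R : Type*} [CommRing R] (J : Ideal R) {M M' : Type*}
    [AddCommGroup M] [Module R M] [AddCommGroup M'] [Module R M'] (f : M →ₗ[R] M') {z : M}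
    (hz : z ∈ J.powTorsion M) : f z ∈ J.powTorsion M' := by
  obtain ⟨k, hk⟩ := hz
  exact ⟨k, fun r hr => by rw [← map_smul, hk r hr, map_zero]⟩

lemma Ideal.powTorsion_anti {R : Type*} [CommRing R] {J K : Ideal R} (h : J ≤ K) (M : Type*)
    [AddCommGroup M] [Module R M] : K.powTorsion M ≤ J.powTorsion M :=
  fun _ ⟨k, hk⟩ => ⟨k, fun r hr => hk r (Ideal.pow_right_mono h k hr)⟩

namespace localCohomology

variable {R : Type u} [CommRing R] (J : Ideal R)

/-- The morphism `R ⧸ J ^ k ⟶ X` sending `1` to an element annihilated by `J ^ k`. -/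
noncomputable def powHom {X : ModuleCat.{u} R} (k : ℕ) (z : X) (hz : ∀ r ∈ J ^ k, r • z = 0) :
    ModuleCat.of R (R ⧸ J ^ k) ⟶ X :=
  ModuleCat.ofHom ((J ^ k).liftQ (LinearMap.toSpanSingleton R X z) hz)

lemma powHom_one {X : ModuleCat.{u} R} (k : ℕ) (z : X) (hz : ∀ r ∈ J ^ k, r • z = 0) :
    powHom J k z hz (Submodule.Quotient.mk (1 : R)) = z :=
  one_smul R z

lemma hom_ext_one {X : ModuleCat.{u} R} {k : ℕ} {f g : ModuleCat.of R (R ⧸ J ^ k) ⟶ X}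
    (h : f (Submodule.Quotient.mk (1 : R)) = g (Submodule.Quotient.mk (1 : R))) : f = g := by
  refine ModuleCat.hom_ext (Submodule.linearMap_qext _ (LinearMap.ext_ring h))

lemma smul_apply_one {X : ModuleCat.{u} R} {k : ℕ} (f : ModuleCat.of R (R ⧸ J ^ k) ⟶ X) :
    ∀ r ∈ J ^ k, r • f (Submodule.Quotient.mk (1 : R)) = 0 := by
  intro r hr
  have h : r • (Submodule.Quotient.mk (1 : R) : R ⧸ J ^ k) = 0 :=
    (Submodule.Quotient.mk_eq_zero _).2 (by simpa using hr)
  exact (f.hom.map_smul r _).symm.trans ((congrArg f.hom h).trans (map_zero f.hom))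

variable {N : ModuleCat.{u} R} (I : InjectiveResolution N)

/-- The cocycles of the `J`-torsion part of an injective resolution. -/
noncomputable def torsionCocycles (n : ℕ) : Submodule R (I.cocomplex.X n) :=
  LinearMap.ker (I.cocomplex.d n (n + 1)).hom ⊓ J.powTorsion _

lemma mem_torsionCocycles {n : ℕ} {z : I.cocomplex.X n} :
    z ∈ torsionCocycles J I n ↔
      I.cocomplex.d n (n + 1) z = 0 ∧ ∃ k : ℕ, ∀ r ∈ J ^ k, r • z = 0 :=
  Iff.rfl

/-- The coboundaries of the `J`-torsion part of an injective resolution. -/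
noncomputable def torsionCoboundaries (n : ℕ) : Submodule R (I.cocomplex.X (n + 1)) :=
  (J.powTorsion _).map (I.cocomplex.d n (n + 1)).hom

lemma powHom_comp_d {n k : ℕ} (z : I.cocomplex.X n) (hz : ∀ r ∈ J ^ k, r • z = 0)
    (hd : I.cocomplex.d n (n + 1) z = 0) :
    powHom J k z hz ≫ I.cocomplex.d n (n + 1) = 0 :=
  hom_ext_one J ((congrArg (I.cocomplex.d n (n + 1)) (powHom_one J k z hz)).trans hd)

/-- The local cohomology class of a cocycle annihilated by `J ^ k`. -/
noncomputable def classOf {p : ℕ} (k : ℕ) (z : I.cocomplex.X (p + 1))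
    (hz : ∀ r ∈ J ^ k, r • z = 0) (hd : I.cocomplex.d (p + 1) (p + 1 + 1) z = 0) :
    (localCohomology J (p + 1)).obj N :=
  ofExt J p N k (I.extMk (powHom J k z hz) (p + 1 + 1) rfl (powHom_comp_d J I z hz hd))

lemma quotientPowMap_comp_powHom {X : ModuleCat.{u} R} {k l : ℕ} (h : k ≤ l) (z : X)
    (hz : ∀ r ∈ J ^ k, r • z = 0) :
    quotientPowMap J h ≫ powHom J k z hz =
      powHom J l z (fun r hr => hz r (Ideal.pow_le_pow_right h hr)) :=
  hom_ext_one J rfl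

lemma extMk_congr {X : ModuleCat.{u} R} {n m : ℕ} {f g : X ⟶ I.cocomplex.X n} (h : f = g)
    (hm : n + 1 = m) (hf : f ≫ I.cocomplex.d n m = 0) :
    I.extMk f m hm hf = I.extMk g m hm (h ▸ hf) := by
  subst h
  rfl

lemma classOf_eq_of_le {p k l : ℕ} (h : k ≤ l) (z : I.cocomplex.X (p + 1))
    (hk : ∀ r ∈ J ^ k, r • z = 0)
    (hl : ∀ r ∈ J ^ l, r • z = 0) (hd : I.cocomplex.d (p + 1) (p + 1 + 1) z = 0) :
    classOf J I k z hk hd = classOf J I l z hl hd := by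
  refine (ofExt_comp J p N h _).symm.trans (congrArg (ofExt J p N l) ?_)
  exact (I.mk₀_comp_extMk _ _ _ _ _).trans
    (extMk_congr I (quotientPowMap_comp_powHom J h z hk) _ _)

lemma classOf_eq {p k l : ℕ} (z : I.cocomplex.X (p + 1)) (hk : ∀ r ∈ J ^ k, r • z = 0)
    (hl : ∀ r ∈ J ^ l, r • z = 0) (hd : I.cocomplex.d (p + 1) (p + 1 + 1) z = 0) :
    classOf J I k z hk hd = classOf J I l z hl hd := by
  rcases le_total k l with h | h
  · exact classOf_eq_of_le J I h z hk hl hd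
  · exact (classOf_eq_of_le J I h z hl hk hd).symm

lemma classOf_add {p k : ℕ} (z w : I.cocomplex.X (p + 1)) (hz : ∀ r ∈ J ^ k, r • z = 0)
    (hw : ∀ r ∈ J ^ k, r • w = 0) (hzw : ∀ r ∈ J ^ k, r • (z + w) = 0)
    (hdz : I.cocomplex.d (p + 1) (p + 1 + 1) z = 0)
    (hdw : I.cocomplex.d (p + 1) (p + 1 + 1) w = 0)
    (hdzw : I.cocomplex.d (p + 1) (p + 1 + 1) (z + w) = 0) :
    classOf J I k (z + w) hzw hdzw = classOf J I k z hz hdz + classOf J I k w hw hdw := by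
  refine Eq.trans (congrArg (ofExt J p N k) ?_) (map_add (ofExt J p N k) _ _)
  refine Eq.trans (extMk_congr I ?_ _ _) (I.add_extMk _ _ _ _ _ _).symm
  apply hom_ext_one
  exact (powHom_one J _ (z + w) hzw).trans
    (congrArg₂ (· + ·) (powHom_one J _ z hz) (powHom_one J _ w hw)).symm

lemma classOf_smul {p k : ℕ} (s : R) (z : I.cocomplex.X (p + 1)) (hz : ∀ r ∈ J ^ k, r • z = 0)
    (hsz : ∀ r ∈ J ^ k, r • (s • z) = 0) (hdz : I.cocomplex.d (p + 1) (p + 1 + 1) z = 0)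
    (hdsz : I.cocomplex.d (p + 1) (p + 1 + 1) (s • z) = 0) :
    classOf J I k (s • z) hsz hdsz = s • classOf J I k z hz hdz := by
  refine Eq.trans (congrArg (ofExt J p N k) ?_) (map_smul (ofExt J p N k) s _)
  rw [← Abelian.Ext.mk₀_id_comp (I.extMk (powHom J k z hz) _ _ _),
    ← Abelian.Ext.smul_comp, ← Abelian.Ext.mk₀_smul, I.mk₀_comp_extMk]
  apply extMk_congr
  apply hom_ext_one
  refine (powHom_one J _ (s • z) hsz).trans ?_
  exact (((powHom J k z hz).hom.map_smul s (Submodule.Quotient.mk (1 : R))).trans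
    (congrArg (s • ·) (powHom_one J _ z hz))).symm

/-- The local cohomology class of a torsion cocycle of an injective resolution. -/
noncomputable def cocycleClass (p : ℕ) :
    torsionCocycles J I (p + 1) →ₗ[R] (localCohomology J (p + 1)).obj N where
  toFun z := classOf J I ((mem_torsionCocycles J I).1 z.2).2.choose z.1
    ((mem_torsionCocycles J I).1 z.2).2.choose_spec ((mem_torsionCocycles J I).1 z.2).1
  map_add' z w := by
    obtain ⟨k, hk⟩ := z.2.2
    obtain ⟨l, hl⟩ := w.2.2
    have hk' : ∀ r ∈ J ^ max k l, r • z.1 = 0 := fun r hr =>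
      hk r (Ideal.pow_le_pow_right (le_max_left k l) hr)
    have hl' : ∀ r ∈ J ^ max k l, r • w.1 = 0 := fun r hr =>
      hl r (Ideal.pow_le_pow_right (le_max_right k l) hr)
    have hkl : ∀ r ∈ J ^ max k l, r • (z.1 + w.1) = 0 := fun r hr => by
      rw [smul_add, hk' r hr, hl' r hr, add_zero]
    exact (classOf_eq J I _ _ hkl _).trans
      ((classOf_add J I z.1 w.1 hk' hl' hkl z.2.1 w.2.1 (z + w).2.1).trans
        (congrArg₂ (· + ·) (classOf_eq J I _ hk' _ _) (classOf_eq J I _ hl' _ _)))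
  map_smul' s z := by
    obtain ⟨k, hk⟩ := z.2.2
    have hs : ∀ r ∈ J ^ k, r • (s • z.1) = 0 := fun r hr => by
      rw [smul_comm, hk r hr, smul_zero]
    exact (classOf_eq J I _ _ hs _).trans
      ((classOf_smul J I s z.1 hk hs z.2.1 (s • z).2.1).trans
        (congrArg (s • ·) (classOf_eq J I _ hk _ _)))

lemma cocycleClass_eq {p k : ℕ} (z : torsionCocycles J I (p + 1))
    (hk : ∀ r ∈ J ^ k, r • z.1 = 0) :
    cocycleClass J I p z = classOf J I k z.1 hk z.2.1 :=
  classOf_eq J I _ _ _ _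

lemma cocycleClass_surjective (p : ℕ) : Function.Surjective (cocycleClass J I p) := by
  intro y
  obtain ⟨k, α, rfl⟩ := exists_ofExt_eq J p N y
  obtain ⟨f, hf, rfl⟩ := I.extMk_surjective α (p + 1 + 1) rfl
  have hk := smul_apply_one J f
  have hd : I.cocomplex.d (p + 1) (p + 1 + 1) (f (Submodule.Quotient.mk (1 : R))) = 0 :=
    congr($hf (Submodule.Quotient.mk (1 : R)))
  refine ⟨⟨_, hd, k, hk⟩, (cocycleClass_eq J I _ hk).trans ?_⟩
  exact congrArg (ofExt J p N k) (extMk_congr I (hom_ext_one J (powHom_one J _ _ hk)) _ _)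

lemma cocycleClass_eq_zero_iff {p : ℕ} (z : torsionCocycles J I (p + 1)) :
    cocycleClass J I p z = 0 ↔ z.1 ∈ torsionCoboundaries J I p := by
  obtain ⟨z, hz, k, hk⟩ := z
  constructor
  · intro h
    rw [cocycleClass_eq J I _ hk] at h
    obtain ⟨l, hkl, h⟩ := exists_comp_eq_zero_of_ofExt_eq_zero J p N _ h
    rw [I.mk₀_comp_extMk, I.extMk_eq_zero_iff _ _ _ _ p rfl] at h
    obtain ⟨g, hg⟩ := h
    refine ⟨g (Submodule.Quotient.mk (1 : R)), ⟨l, smul_apply_one J g⟩, ?_⟩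
    exact congr($hg (Submodule.Quotient.mk (1 : R))).trans (powHom_one J k z hk)
  · rintro ⟨w, ⟨l, hl⟩, rfl⟩
    have hl' : ∀ r ∈ J ^ l, r • (I.cocomplex.d p (p + 1)).hom w = 0 := fun r hr => by
      rw [← map_smul, hl r hr, map_zero]
    refine (cocycleClass_eq J I _ hl').trans (Eq.trans (congrArg (ofExt J p N l) ?_) (map_zero _))
    refine (I.extMk_eq_zero_iff _ _ rfl _ p rfl).2 ⟨powHom J l w hl, hom_ext_one J ?_⟩
    exact (congrArg (I.cocomplex.d p (p + 1)) (powHom_one J l w hl)).trans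
      (powHom_one J l _ hl').symm

end localCohomology

lemma Ideal.mem_powTorsion_sup_span_singleton {R : Type*} [CommRing R] (J : Ideal R) (x : R)
    {M : Type*} [AddCommGroup M] [Module R M] {z : M} (hz : z ∈ J.powTorsion M) {m : ℕ}
    (hm : x ^ m • z = 0) : z ∈ (J ⊔ Ideal.span {x}).powTorsion M := by
  obtain ⟨k, hk⟩ := hz
  refine ⟨k + m, fun r hr => ?_⟩
  obtain ⟨a, ha, b, hb, rfl⟩ := Submodule.mem_sup.1 (Ideal.sup_pow_add_le_pow_sup_pow hr)
  rw [Ideal.span_singleton_pow] at hb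
  obtain ⟨s, rfl⟩ := Ideal.mem_span_singleton'.1 hb
  rw [add_smul, hk a ha, mul_smul, hm, smul_zero, add_zero]

lemma Ideal.exists_pow_smul_eq_zero_of_mul_pow_mem {R : Type u} [CommRing R]
    [IsNoetherianRing R] (J : Ideal R) (x : R) (k : ℕ) {M : Type*} [AddCommGroup M] [Module R M]
    {c : M} (hc : c ∈ J.powTorsion M) :
    ∃ m n : ℕ, ∀ r : R, r * x ^ (m + k) ∈ J ^ n → r • x ^ m • c = 0 := by
  obtain ⟨j, hj⟩ := hc
  let f : ℕ →o Ideal R :=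
    { toFun := fun n => LinearMap.ker (LinearMap.toSpanSingleton R R (x ^ n))
      monotone' := fun a b hab r hr => by
        simp only [LinearMap.mem_ker, LinearMap.toSpanSingleton_apply, smul_eq_mul] at hr ⊢
        rw [← Nat.add_sub_cancel' hab, pow_add, ← mul_assoc, hr, zero_mul] }
  obtain ⟨m, hm⟩ := monotone_stabilizes_iff_noetherian.2 ‹IsNoetherianRing R› f
  obtain ⟨q, hq⟩ := J.exists_pow_inf_eq_pow_smul (Ideal.span {x ^ (m + k)})
  refine ⟨m, q + j, fun r hr => ?_⟩
  have h1 : r * x ^ (m + k) ∈ J ^ (q + j) • (⊤ : Ideal R) ⊓ Ideal.span {x ^ (m + k)} :=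
    ⟨by simpa using hr, Ideal.mem_span_singleton'.2 ⟨r, rfl⟩⟩
  rw [hq (q + j) (Nat.le_add_right q j), Nat.add_sub_cancel_left] at h1
  have h2 : r * x ^ (m + k) ∈ J ^ j * Ideal.span {x ^ (m + k)} :=
    Submodule.smul_mono le_rfl inf_le_right h1
  obtain ⟨s, hs, hsr⟩ := Ideal.mem_mul_span_singleton.1 h2
  have h3 : r - s ∈ f (m + k) := by
    change (r - s) * x ^ (m + k) = 0
    rw [sub_mul, hsr, sub_self]
  rw [← hm (m + k) (Nat.le_add_right m k)] at h3
  have h4 : r * x ^ m = s * x ^ m := sub_eq_zero.1 ((sub_mul _ _ _).symm.trans h3)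
  rw [← mul_smul, h4, mul_comm, mul_smul, hj s hs, smul_zero]

/-- Over a Noetherian ring, the `J`-power torsion of an injective module is divisible by powers of
`x` up to `x`-power torsion. -/
lemma Ideal.exists_powTorsion_pow_smul_sub_eq_zero {R : Type u} [CommRing R]
    [IsNoetherianRing R] (J : Ideal R) (x : R) (k : ℕ) {E : Type u} [AddCommGroup E] [Module R E]
    [Module.Injective R E] {c : E} (hc : c ∈ J.powTorsion E) :
    ∃ c' ∈ J.powTorsion E, ∃ m : ℕ, x ^ m • (c - x ^ k • c') = 0 := by
  obtain ⟨m, n, h⟩ := J.exists_pow_smul_eq_zero_of_mul_pow_mem x k hc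
  let μ : R →ₗ[R] R := LinearMap.toSpanSingleton R R (x ^ (m + k))
  let K : Submodule R R := Submodule.comap μ (J ^ n)
  let f : (R ⧸ K) →ₗ[R] (R ⧸ J ^ n) := K.mapQ (J ^ n) μ le_rfl
  have hf : Function.Injective f := by
    rw [← LinearMap.ker_eq_bot]
    exact Submodule.ker_liftQ_eq_bot _ _ _ (by rw [LinearMap.ker_comp, Submodule.ker_mkQ])
  let g : (R ⧸ K) →ₗ[R] E := K.liftQ (LinearMap.toSpanSingleton R E (x ^ m • c)) h
  obtain ⟨e, he⟩ := Module.Injective.out f hf g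
  have h1 : x ^ (m + k) • e (Submodule.Quotient.mk 1) = x ^ m • c := by
    have h2 := he (Submodule.Quotient.mk 1)
    have h3 : f (Submodule.Quotient.mk 1) =
        x ^ (m + k) • (Submodule.Quotient.mk 1 : R ⧸ J ^ n) := by
      change (Submodule.Quotient.mk ((1 : R) • x ^ (m + k)) : R ⧸ J ^ n) = _
      rw [← Submodule.Quotient.mk_smul, smul_eq_mul, smul_eq_mul, mul_comm]
    rw [h3, map_smul] at h2
    exact h2.trans (one_smul R _)
  refine ⟨e (Submodule.Quotient.mk 1), ⟨n, fun r hr => ?_⟩, m, ?_⟩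
  · rw [← map_smul, ← Submodule.Quotient.mk_smul,
      (Submodule.Quotient.mk_eq_zero (J ^ n)).2 (by simpa using hr), map_zero]
  · rw [smul_sub, ← mul_smul, ← pow_add, h1, sub_self]

lemma Ideal.exists_powTorsion_sup_preimage {R : Type u} [CommRing R] [IsNoetherianRing R]
    (J : Ideal R) (x : R) {E₀ E₁ E₂ H : Type u} [AddCommGroup E₀] [Module R E₀]
    [AddCommGroup E₁] [Module R E₁] [AddCommGroup E₂] [Module R E₂] [AddCommGroup H] [Module R H]
    [Module.Injective R E₀] [IsArtinian R H] (d₀ : E₀ →ₗ[R] E₁) (d₁ : E₁ →ₗ[R] E₂)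
    (hd : ∀ w, d₁ (d₀ w) = 0) (τ : ↥(LinearMap.ker d₁ ⊓ J.powTorsion E₁) →ₗ[R] H)
    (hτ : Function.Surjective τ)
    (hτ' : ∀ z, τ z = 0 → z.1 ∈ (J.powTorsion E₀).map d₀) {c : E₁} (hc : c ∈ J.powTorsion E₁)
    {k : ℕ} (hk : x ^ k • d₁ c = 0) :
    ∃ c' ∈ (J ⊔ Ideal.span {x}).powTorsion E₁, d₁ c' = d₁ c := by
  let ζ : ↥(LinearMap.ker d₁ ⊓ J.powTorsion E₁) :=
    ⟨x ^ k • c, LinearMap.mem_ker.2 (by rw [map_smul, hk]), Submodule.smul_mem _ _ hc⟩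
  obtain ⟨n, v, hv⟩ := IsArtinian.exists_pow_succ_smul_dvd (x ^ k) (τ ζ)
  obtain ⟨y, rfl⟩ := hτ v
  have h0 : τ ((x ^ k) ^ n • ζ - (x ^ k) ^ (n + 1) • y) = 0 := by
    rw [map_sub, map_smul, map_smul]
    exact sub_eq_zero.2 hv.symm
  obtain ⟨w, hw, hwd⟩ := hτ' _ h0
  have hP : d₀ w = x ^ (k * (n + 1)) • (c - y.1) := by
    rw [hwd, smul_sub, pow_mul, pow_succ]
    simp only [Submodule.coe_sub, Submodule.coe_smul, ζ, mul_smul]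
  obtain ⟨w', hw', m, hm⟩ := J.exists_powTorsion_pow_smul_sub_eq_zero x (k * (n + 1)) hw
  refine ⟨c - y.1 - d₀ w', J.mem_powTorsion_sup_span_singleton x
    (Submodule.sub_mem _ (Submodule.sub_mem _ hc y.2.2) (J.map_mem_powTorsion d₀ hw'))
    (m := m + k * (n + 1)) ?_, ?_⟩
  · rw [pow_add, mul_smul, smul_sub _ (c - y.1), ← hP, ← map_smul, ← map_sub, ← map_smul, hm,
      map_zero]
  · rw [map_sub, map_sub, hd, sub_zero, LinearMap.mem_ker.1 y.2.1, sub_zero]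

namespace localCohomology

variable {R : Type u} [CommRing R] [IsNoetherianRing R]

lemma isArtinian_sup_span_singleton (J : Ideal R) (x : R) (N : ModuleCat.{u} R) (p : ℕ)
    (h₁ : IsArtinian R ((localCohomology J (p + 1)).obj N))
    (h₂ : IsArtinian R ((localCohomology J (p + 1 + 1)).obj N)) :
    IsArtinian R ((localCohomology (J ⊔ Ideal.span {x}) (p + 1 + 1)).obj N) := by
  let I := injectiveResolution N
  let K := J ⊔ Ideal.span {x}
  have hle : torsionCocycles K I (p + 1 + 1) ≤ torsionCocycles J I (p + 1 + 1) :=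
    inf_le_inf_left _ (Ideal.powTorsion_anti le_sup_left _)
  let σ := cocycleClass J I (p + 1) ∘ₗ Submodule.inclusion hle
  have hE : Module.Injective R (I.cocomplex.X p) :=
    Module.injective_module_of_injective_object R _ (inj := I.injective p)
  have hker : LinearMap.ker σ ≤ LinearMap.ker (cocycleClass K I (p + 1)) := by
    intro z hz
    obtain ⟨c, hc, hcz⟩ := (cocycleClass_eq_zero_iff J I _).1 (LinearMap.mem_ker.1 hz)
    obtain ⟨k, hk⟩ := ((mem_torsionCocycles K I).1 z.2).2
    have hxk : x ^ k • (I.cocomplex.d (p + 1) (p + 1 + 1)).hom c = 0 := by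
      refine (congrArg (x ^ k • ·) hcz).trans (hk _ (Ideal.pow_mem_pow ?_ k))
      exact Ideal.mem_sup_right (Ideal.mem_span_singleton_self x)
    obtain ⟨c', hc', h⟩ := J.exists_powTorsion_sup_preimage x
      (I.cocomplex.d p (p + 1)).hom (I.cocomplex.d (p + 1) (p + 1 + 1)).hom
      (fun w => congr($(I.cocomplex.d_comp_d p (p + 1) (p + 1 + 1)) w))
      (cocycleClass J I p) (cocycleClass_surjective J I p)
      (fun z hz => (cocycleClass_eq_zero_iff J I z).1 hz) hc hxk
    exact (cocycleClass_eq_zero_iff K I z).2 ⟨c', hc', h.trans hcz⟩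
  have : IsArtinian R (_ ⧸ LinearMap.ker σ) :=
    isArtinian_of_injective ((LinearMap.ker σ).liftQ σ le_rfl)
      (LinearMap.ker_eq_bot.1 (Submodule.ker_liftQ_eq_bot _ _ _ le_rfl))
  refine isArtinian_of_surjective _ ((LinearMap.ker σ).liftQ (cocycleClass K I (p + 1)) hker) ?_
  intro y
  obtain ⟨z, rfl⟩ := cocycleClass_surjective K I (p + 1) y
  exact ⟨Submodule.Quotient.mk z, rfl⟩

lemma isArtinian_sup_span_range (N : ModuleCat.{u} R) (n : ℕ) (x : Fin n → R) (J : Ideal R)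
    (t : ℕ) (h : ∀ i, t < i → IsArtinian R ((localCohomology J i).obj N)) (i : ℕ)
    (hi : t + n < i) :
    IsArtinian R ((localCohomology (J ⊔ Ideal.span (Set.range x)) i).obj N) := by
  induction n generalizing J t with
  | zero =>
    rw [Set.range_eq_empty, Ideal.span_empty, sup_bot_eq]
    exact h i hi
  | succ n ih =>
    rw [Fin.range_fin_succ, Ideal.span_insert, ← sup_assoc]
    refine ih (fun j => x j.succ) _ (t + 1) (fun j hj => ?_) (by lia)
    obtain ⟨p, rfl⟩ : ∃ p, j = p + 1 + 1 := ⟨j - 2, by lia⟩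
    exact isArtinian_sup_span_singleton J (x 0) N p (h _ (by lia)) (h _ (by lia))

end localCohomology

theorem artinianness_dim_le_add_ara
    {R : Type u} [CommRing R] [IsNoetherianRing R]
    (𝔞 𝔟 : Ideal R) (h_le : 𝔞 ≤ 𝔟)
    (N : Type u) [AddCommGroup N] [Module R N] [Module.Finite R N]
    (n : ℕ) (x : Fin n → R)
    (h_rad : (𝔞 ⊔ Ideal.span (Set.range x)).radical = 𝔟.radical)
    (t : ℕ)
    (h_art : ∀ i, t < i → IsArtinian R ((localCohomology 𝔞 i).obj (ModuleCat.of R N))) :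
    ∀ i, t + n < i → IsArtinian R ((localCohomology 𝔟 i).obj (ModuleCat.of R N)) := by
  intro i hi
  have := localCohomology.isArtinian_sup_span_range (ModuleCat.of R N) n x 𝔞 t h_art i hi
  exact isArtinian_of_linearEquiv
    ((localCohomology.isoOfSameRadical h_rad i).app (ModuleCat.of R N)).toLinearEquiv
end

section
/- Let R be a commutative Noetherian ring, 𝔞 an ideal of R, N a finitely generated R-module, and S a multiplicatively closed subset of R. If t is an integer such that H^i_𝔞(N) is Artinian (as an R-module) for all i > t, then H^i_{S⁻¹𝔞}(S⁻¹N) is Artinian as an S⁻¹R-module for all i > t. In particular q_{S⁻¹𝔞}(S⁻¹N) ≤ q_𝔞(N). -/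
/-!
STATEMENT 14: Let R be a commutative Noetherian ring, 𝔞 an ideal of R, N a finitely generated
R-module, and S a multiplicatively closed subset of R. If t is an integer such that H^i_𝔞(N)
is Artinian (as an R-module) for all i > t, then H^i_{S⁻¹𝔞}(S⁻¹N) is Artinian as an
S⁻¹R-module for all i > t (in particular q_{S⁻¹𝔞}(S⁻¹N) ≤ q_𝔞(N)).
-/

open CategoryTheory Opposite

universe u

section

open Limits

theorem LinearMap.surjective_of_isArtinian_of_exists_smul_mem_range
    {R : Type*} [CommRing R] {S : Submonoid R} {A B : Type*} [AddCommGroup A] [AddCommGroup B]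
    [Module R A] [Module R B] [IsArtinian R A] (φ : A →ₗ[R] B)
    (hinj : ∀ s : S, Function.Injective fun b : B ↦ (s : R) • b)
    (hφ : ∀ b, ∃ s : S, (s : R) • b ∈ LinearMap.range φ) : Function.Surjective φ := by
  intro b
  obtain ⟨s, a, ha⟩ := hφ b
  obtain ⟨n, y, hy⟩ := IsArtinian.exists_pow_succ_smul_dvd (s : R) a
  refine ⟨y, hinj (s ^ n.succ) ?_⟩
  simp only [SubmonoidClass.coe_pow]
  rw [← map_smul, hy, map_smul, ha, smul_smul, pow_succ]

theorem CategoryTheory.ShortComplex.exists_smul_mem_range_homologyMap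
    {R : Type*} [CommRing R] (S : Submonoid R) {K L : ShortComplex (ModuleCat.{u} R)} (ψ : K ⟶ L)
    (h₂ : ∀ y : L.X₂, ∃ s : S, (s : R) • y ∈ LinearMap.range ψ.τ₂.hom)
    (h₃ : ∀ x : K.X₃, ψ.τ₃ x = 0 → ∃ s : S, (s : R) • x = 0) (e : L.homology) :
    ∃ s : S, (s : R) • e ∈ LinearMap.range (homologyMap ψ).hom := by
  obtain ⟨z, rfl⟩ := (ModuleCat.epi_iff_surjective L.homologyπ).1 inferInstance e
  obtain ⟨s, x, hx⟩ := h₂ (L.iCycles z)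
  have hz : L.g (L.iCycles z) = 0 := by
    rw [← ConcreteCategory.comp_apply, iCycles_g]; rfl
  obtain ⟨t, ht⟩ := h₃ (K.g x) (by
    rw [← ConcreteCategory.comp_apply, ← ψ.comm₂₃, ConcreteCategory.comp_apply]
    erw [hx]
    rw [map_smul, hz, smul_zero])
  have htx : (t : R) • x ∈ LinearMap.ker K.g.hom := by
    rw [LinearMap.mem_ker, map_smul]; exact ht
  obtain ⟨c, hc⟩ : ∃ c : K.cycles, K.iCycles c = (t : R) • x :=
    ⟨K.moduleCatCyclesIso.inv ⟨(t : R) • x, htx⟩,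
      ConcreteCategory.congr_hom K.moduleCatCyclesIso_inv_iCycles ⟨(t : R) • x, htx⟩⟩
  refine ⟨t * s, K.homologyπ c, ?_⟩
  have h : cyclesMap ψ c = ((t * s : S) : R) • z := by
    apply (ModuleCat.mono_iff_injective L.iCycles).1 inferInstance
    rw [← ConcreteCategory.comp_apply, cyclesMap_i, ConcreteCategory.comp_apply, hc, map_smul,
      map_smul]
    erw [hx]
    rw [smul_smul]; rfl
  rw [← map_smul, ← h]
  exact ConcreteCategory.congr_hom (homologyπ_naturality ψ) c

theorem CategoryTheory.ShortComplex.exists_smul_mem_range_homologyMap_unop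
    {R : Type*} [CommRing R] (S : Submonoid R) {K L : ShortComplex (ModuleCat.{u} R)ᵒᵖ} (ψ : K ⟶ L)
    (h₂ : ∀ y : K.X₂.unop, ∃ s : S, (s : R) • y ∈ LinearMap.range ψ.τ₂.unop.hom)
    (h₁ : ∀ x : L.X₁.unop, ψ.τ₁.unop x = 0 → ∃ s : S, (s : R) • x = 0) (e : K.homology.unop) :
    ∃ s : S, (s : R) • e ∈ LinearMap.range (homologyMap ψ).unop.hom := by
  have key := congrArg Quiver.Hom.unop (homologyOpIso_hom_naturality (unopMap ψ))
  obtain ⟨s, x, hx⟩ := exists_smul_mem_range_homologyMap S (unopMap ψ) h₂ h₁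
    (K.unop.homologyOpIso.inv.unop e)
  refine ⟨s, L.unop.homologyOpIso.hom.unop x, ?_⟩
  have := ConcreteCategory.congr_hom key x
  have hx' : homologyMap (unopMap ψ) x = (s : R) • K.unop.homologyOpIso.inv.unop e := hx
  change (homologyMap ψ).unop (L.unop.homologyOpIso.hom.unop x) =
    K.unop.homologyOpIso.hom.unop (homologyMap (unopMap ψ) x) at this
  refine this.trans ?_
  rw [hx', map_smul]
  exact congrArg ((s : R) • ·)
    (ConcreteCategory.congr_hom (congrArg Quiver.Hom.unop K.unop.homologyOpIso.hom_inv_id) e)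

namespace CategoryTheory
section
variable {C D E E' : Type*} [Category* C] [Category* D] [Category* E] [Category* E'] [Abelian C]
  [Abelian D] [Abelian E] [Abelian E']
  (F : C ⥤ D) [F.Additive]
  (G : D ⥤ E) [G.Additive] (K : E ⥤ E') [K.Additive] [K.PreservesHomology] (n : ℕ)

/-- An exact functor `K` commutes with taking the homology of a chain complex. -/
noncomputable def Functor.homologyMapHomologicalComplexCompIso (L : ChainComplex C ℕ) :
    (HomologicalComplex.homologyFunctor E' _ n).obj (((F ⋙ G ⋙ K).mapHomologicalComplex _).obj L) ≅
      K.obj ((HomologicalComplex.homologyFunctor E _ n).obj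
        ((G.mapHomologicalComplex _).obj ((F.mapHomologicalComplex _).obj L))) :=
  ShortComplex.mapHomologyIso
    (((G.mapHomologicalComplex _).obj ((F.mapHomologicalComplex _).obj L)).sc n) K

theorem Functor.homologyMapHomologicalComplexCompIso_hom_naturality {L M : ChainComplex C ℕ}
    (φ : L ⟶ M) :
    (HomologicalComplex.homologyFunctor E' _ n).map
        (((F ⋙ G ⋙ K).mapHomologicalComplex _).map φ) ≫
      (F.homologyMapHomologicalComplexCompIso G K n M).hom =
    (F.homologyMapHomologicalComplexCompIso G K n L).hom ≫
      K.map ((HomologicalComplex.homologyFunctor E _ n).map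
        ((G.mapHomologicalComplex _).map ((F.mapHomologicalComplex _).map φ))) :=
  ShortComplex.mapHomologyIso_hom_naturality
    ((HomologicalComplex.shortComplexFunctor E _ n).map
      ((G.mapHomologicalComplex _).map ((F.mapHomologicalComplex _).map φ))) K

variable [EnoughProjectives D] [F.PreservesProjectiveObjects] [F.PreservesHomology]

/-- If `F` is exact and preserves projective objects, the left derived functors of `G` at `F.obj X`
can be computed by applying `F` to a projective resolution of `X`. -/
noncomputable def ProjectiveResolution.leftDerivedMapIso {X : C} (P : ProjectiveResolution X) :
    (HomologicalComplex.homologyFunctor E _ n).obj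
        ((G.mapHomologicalComplex _).obj ((F.mapHomologicalComplex _).obj P.complex)) ≅
      (G.leftDerived n).obj (F.obj X) :=
  ((F.mapProjectiveResolution P).isoLeftDerivedObj G n).symm

theorem ProjectiveResolution.leftDerivedMapIso_hom_naturality {X Y : C} (f : X ⟶ Y)
    (P : ProjectiveResolution X) (Q : ProjectiveResolution Y) (φ : P.complex ⟶ Q.complex)
    (h : φ ≫ Q.π = P.π ≫ (ChainComplex.single₀ C).map f) :
    (HomologicalComplex.homologyFunctor E _ n).map
        ((G.mapHomologicalComplex _).map ((F.mapHomologicalComplex _).map φ)) ≫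
      (Q.leftDerivedMapIso F G n).hom =
    (P.leftDerivedMapIso F G n).hom ≫ (G.leftDerived n).map (F.map f) := by
  have h₁ := congrArg ((F.mapHomologicalComplex _).map) h
  rw [Functor.map_comp, Functor.map_comp] at h₁
  have h₂ := (HomologicalComplex.singleMapHomologicalComplex F (ComplexShape.down ℕ)
    0).hom.naturality f
  have h₃ : (F.mapHomologicalComplex _).map φ ≫ (F.mapProjectiveResolution Q).π =
      (F.mapProjectiveResolution P).π ≫ (ChainComplex.single₀ D).map (F.map f) := by
    refine (Category.assoc _ _ _).symm.trans ((h₁ =≫ _).trans ?_)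
    refine (Category.assoc _ _ _).trans (Eq.trans ?_ (Category.assoc _ _ _).symm)
    exact _ ≫= h₂
  refine (ProjectiveResolution.isoLeftDerivedObj_inv_naturality (F.map f)
    (F.mapProjectiveResolution P) (F.mapProjectiveResolution Q)
    ((F.mapHomologicalComplex _).map φ) ?_ G n).symm
  refine (HomologicalComplex.congr_hom h₃ 0).trans ?_
  exact congrArg (_ ≫ ·) (ChainComplex.single₀_map_f_zero _)

variable [EnoughProjectives C]

/-- Computation of `(F ⋙ G ⋙ K).leftDerived n` at `X` from a projective resolution of `X`, when
`F` and `K` are exact and `F` preserves projective objects. -/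
noncomputable def ProjectiveResolution.leftDerivedCompIso {X : C} (P : ProjectiveResolution X) :
    ((F ⋙ G ⋙ K).leftDerived n).obj X ≅ K.obj ((G.leftDerived n).obj (F.obj X)) :=
  P.isoLeftDerivedObj (F ⋙ G ⋙ K) n ≪≫
    F.homologyMapHomologicalComplexCompIso G K n P.complex ≪≫
    K.mapIso (P.leftDerivedMapIso F G n)

theorem ProjectiveResolution.leftDerivedCompIso_hom_naturality {X Y : C} (f : X ⟶ Y)
    (P : ProjectiveResolution X) (Q : ProjectiveResolution Y) :
    ((F ⋙ G ⋙ K).leftDerived n).map f ≫ (Q.leftDerivedCompIso F G K n).hom =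
      (P.leftDerivedCompIso F G K n).hom ≫ K.map ((G.leftDerived n).map (F.map f)) := by
  have h₁ := ProjectiveResolution.isoLeftDerivedObj_hom_naturality f P Q
    (ProjectiveResolution.lift f P Q) (ProjectiveResolution.lift_commutes_zero f P Q)
    (F ⋙ G ⋙ K) n
  have h₂ := leftDerivedMapIso_hom_naturality F G n f P Q
    (ProjectiveResolution.lift f P Q) (ProjectiveResolution.lift_commutes f P Q)
  have h₃ := Functor.homologyMapHomologicalComplexCompIso_hom_naturality F G K n
    (ProjectiveResolution.lift f P Q)
  simp only [leftDerivedCompIso, Iso.trans_hom, Functor.mapIso_hom, Category.assoc]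
  rw [reassoc_of% h₁, ← K.map_comp, ← h₂, K.map_comp, ← reassoc_of% h₃]

/-- Left derived functors commute with precomposition by an exact functor preserving projectives
and with postcomposition by an exact functor. -/
noncomputable def Functor.leftDerivedCompNatIso :
    (F ⋙ G ⋙ K).leftDerived n ≅ F ⋙ G.leftDerived n ⋙ K :=
  NatIso.ofComponents (fun X ↦ (ProjectiveResolution.of X).leftDerivedCompIso F G K n)
    fun f ↦ ProjectiveResolution.leftDerivedCompIso_hom_naturality F G K n f _ _

end
end CategoryTheory

section
variable {R : Type u} [CommRing R] (S : Submonoid R) (N : ModuleCat.{u} R)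

theorem ModuleCat.localizedModuleFunctor_map_smul {X : ModuleCat.{u} R} (r : R) (f : X ⟶ N) :
    (ModuleCat.localizedModuleFunctor.{u} S).map (r • f) =
      algebraMap R (Localization S) r • (ModuleCat.localizedModuleFunctor.{u} S).map f := by
  ext x
  refine (LinearMap.congr_fun ((IsLocalizedModule.mapExtendScalars S
    (X.localizedModuleMkLinearMap S) (N.localizedModuleMkLinearMap S)
    (Localization S)).map_smul r f.hom) x).trans ?_
  exact (algebraMap_smul (M := N.localizedModule S) (Localization S) r _).symm

/-- The localization maps `Hom(X, N) → Hom(S⁻¹X, S⁻¹N)`, natural in `X`. -/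
noncomputable def ModuleCat.localizedHom :
    ModuleCat.localizedModuleFunctor.{u} S ⋙
      ((linearYoneda (Localization S) _).obj
        ((ModuleCat.localizedModuleFunctor.{u} S).obj N)).rightOp ⋙
        (ModuleCat.restrictScalars.{u} (algebraMap R (Localization S))).op ⟶
      ((linearYoneda R (ModuleCat.{u} R)).obj N).rightOp where
  app X := (ModuleCat.ofHom (X := X ⟶ N)
    (Y := (ModuleCat.restrictScalars.{u} (algebraMap R (Localization S))).obj
      (ModuleCat.of _ ((ModuleCat.localizedModuleFunctor.{u} S).obj X ⟶
        (ModuleCat.localizedModuleFunctor.{u} S).obj N)))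
    { toFun f := (ModuleCat.localizedModuleFunctor.{u} S).map f
      map_add' f g := Functor.map_add _
      map_smul' r f := ModuleCat.localizedModuleFunctor_map_smul S N r f }).op
  naturality X Y f := by
    apply Quiver.Hom.unop_inj
    ext g
    exact ((ModuleCat.localizedModuleFunctor.{u} S).map_comp f g).symm

theorem ModuleCat.exists_smul_eq_localizedModuleFunctor_map [IsNoetherianRing R]
    (X : ModuleCat.{u} R) [Module.Finite R X]
    (y : (ModuleCat.localizedModuleFunctor.{u} S).obj X ⟶
      (ModuleCat.localizedModuleFunctor.{u} S).obj N) :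
    ∃ (s : S) (f : X ⟶ N), (ModuleCat.localizedModuleFunctor.{u} S).map f =
      (algebraMap R (Localization S) s) • y := by
  have : Module.FinitePresentation R X := Module.finitePresentation_of_finite R X
  obtain ⟨⟨f, s⟩, h⟩ := IsLocalizedModule.surj S (IsLocalizedModule.mapExtendScalars S
    (X.localizedModuleMkLinearMap S) (N.localizedModuleMkLinearMap S) (Localization S)) y.hom
  refine ⟨s, ModuleCat.ofHom f, ?_⟩
  ext x
  refine (LinearMap.congr_fun h.symm x).trans ?_
  exact (algebraMap_smul (M := N.localizedModule S) (Localization S) (s : R) _).symm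

theorem ModuleCat.exists_smul_eq_zero_of_localizedModuleFunctor_map_eq_zero (X : ModuleCat.{u} R)
    [Module.Finite R X] [IsNoetherianRing R] (f : X ⟶ N)
    (h : (ModuleCat.localizedModuleFunctor.{u} S).map f = 0) :
    ∃ s : S, (s : R) • f = 0 := by
  have : Module.FinitePresentation R X := Module.finitePresentation_of_finite R X
  obtain ⟨s, hs⟩ := (IsLocalizedModule.eq_zero_iff S (IsLocalizedModule.mapExtendScalars S
    (X.localizedModuleMkLinearMap S) (N.localizedModuleMkLinearMap S) (Localization S))).1
      (congrArg ModuleCat.Hom.hom h)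
  exact ⟨s, ModuleCat.hom_ext hs⟩

variable (i : ℕ)

/-- The maps `Ext(X, N) → Ext(S⁻¹X, S⁻¹N)` induced by localization, natural in `X`. -/
noncomputable def ModuleCat.leftDerivedLocalizedHom :
    ModuleCat.localizedModuleFunctor.{u} S ⋙
      ((linearYoneda (Localization S) _).obj
        ((ModuleCat.localizedModuleFunctor.{u} S).obj N)).rightOp.leftDerived i ⋙
        (ModuleCat.restrictScalars.{u} (algebraMap R (Localization S))).op ⟶
      ((linearYoneda R (ModuleCat.{u} R)).obj N).rightOp.leftDerived i :=
  (Functor.leftDerivedCompNatIso _ _ _ i).inv ≫ NatTrans.leftDerived (ModuleCat.localizedHom S N) i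

theorem ModuleCat.exists_smul_mem_range_unop_of_isIso {X Y Z W : (ModuleCat.{u} R)ᵒᵖ}
    (f : X ⟶ Y) (g : Y ⟶ Z) (h : Z ⟶ W) [IsIso f] [IsIso h]
    (hg : ∀ e : Y.unop, ∃ s : S, (s : R) • e ∈ LinearMap.range g.unop.hom) (e : X.unop) :
    ∃ s : S, (s : R) • e ∈ LinearMap.range (f ≫ g ≫ h).unop.hom := by
  obtain ⟨s, z, hz⟩ := hg ((inv f).unop e)
  refine ⟨s, (inv h).unop z, ?_⟩
  change f.unop (g.unop (((inv h).unop ≫ h.unop) z)) = _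
  rw [← unop_comp, IsIso.hom_inv_id]
  have hz' : g.unop z = (s : R) • (inv f).unop e := hz
  change f.unop (g.unop z) = _
  rw [hz', map_smul]
  refine congrArg _ ?_
  change ((inv f).unop ≫ f.unop) e = _
  rw [← unop_comp, IsIso.hom_inv_id]
  rfl

theorem ModuleCat.exists_smul_mem_range_leftDerivedLocalizedHom [IsNoetherianRing R]
    {X : ModuleCat.{u} R} (P : ProjectiveResolution X) (hP : ∀ n, Module.Finite R (P.complex.X n))
    (e : (((ModuleCat.localizedModuleFunctor.{u} S ⋙
      ((linearYoneda (Localization S) _).obj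
        ((ModuleCat.localizedModuleFunctor.{u} S).obj N)).rightOp.leftDerived i ⋙
        (ModuleCat.restrictScalars.{u} (algebraMap R (Localization S))).op)).obj X).unop) :
    ∃ s : S, (s : R) • e ∈
      LinearMap.range ((ModuleCat.leftDerivedLocalizedHom S N i).app X).unop.hom := by
  have h : (ModuleCat.leftDerivedLocalizedHom S N i).app X =
    ((Functor.leftDerivedCompNatIso _ _ _ i).inv.app X ≫ (P.isoLeftDerivedObj _ i).hom) ≫
      (HomologicalComplex.homologyFunctor _ _ i).map
        ((NatTrans.mapHomologicalComplex (ModuleCat.localizedHom S N) _).app P.complex) ≫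
      (P.isoLeftDerivedObj _ i).inv := by
    rw [Category.assoc, ← ProjectiveResolution.leftDerived_app_eq]
    rfl
  rw [h]
  refine ModuleCat.exists_smul_mem_range_unop_of_isIso S _ _ _ ?_ e
  refine ShortComplex.exists_smul_mem_range_homologyMap_unop S _ ?_ ?_
  · intro y
    obtain ⟨s, f, hf⟩ := ModuleCat.exists_smul_eq_localizedModuleFunctor_map S N (P.complex.X i) y
    exact ⟨s, f, hf⟩
  · intro x hx
    exact ModuleCat.exists_smul_eq_zero_of_localizedModuleFunctor_map_eq_zero S N _ x hx

end

section
variable {R : Type u} [CommRing R] [IsNoetherianRing R]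

theorem FGModuleCat.projective_of_pi (n : ℕ) :
    Projective (FGModuleCat.of R (ULift.{u} (Fin n) → R)) where
  factors {E X} f e he := by
    have he' := (ModuleCat.epi_iff_surjective ((forget₂ (FGModuleCat R) (ModuleCat R)).map e)).1
      inferInstance
    obtain ⟨g, hg⟩ := Module.projective_lifting_property e.hom.hom f.hom.hom he'
    exact ⟨FGModuleCat.ofHom g, FGModuleCat.hom_ext hg⟩

theorem FGModuleCat.exists_epi_of_pi (X : FGModuleCat.{u} R) :
    ∃ (n : ℕ) (f : FGModuleCat.of R (ULift.{u} (Fin n) → R) ⟶ X), Epi f := by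
  obtain ⟨n, f, hf⟩ := Module.Finite.exists_fin' R X
  let e : (ULift.{u} (Fin n) → R) ≃ₗ[R] (Fin n → R) := LinearEquiv.funCongrLeft R R Equiv.ulift.symm
  let g : FGModuleCat.of R (ULift.{u} (Fin n) → R) ⟶ X := FGModuleCat.ofHom (f ∘ₗ e.toLinearMap)
  refine ⟨n, g, ?_⟩
  apply (forget₂ (FGModuleCat R) (ModuleCat R)).epi_of_epi_map
  exact (ModuleCat.epi_iff_surjective _).2 (hf.comp e.surjective)

instance : EnoughProjectives (FGModuleCat.{u} R) where
  presentation X := by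
    obtain ⟨n, f, hf⟩ := FGModuleCat.exists_epi_of_pi X
    exact ⟨{ p := _, projective := FGModuleCat.projective_of_pi n, f := f, epi := hf }⟩

instance : (forget₂ (FGModuleCat.{u} R) (ModuleCat.{u} R)).PreservesProjectiveObjects where
  projective_obj {X} hX := by
    obtain ⟨n, f, hf⟩ := FGModuleCat.exists_epi_of_pi X
    have : Projective ((forget₂ (FGModuleCat R) (ModuleCat R)).obj
        (FGModuleCat.of R (ULift.{u} (Fin n) → R))) :=
      (IsProjective.iff_projective (R := R) (ULift.{u} (Fin n) → R)).1 inferInstance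
    have r : Retract X (FGModuleCat.of R (ULift.{u} (Fin n) → R)) :=
      { i := Projective.factorThru (𝟙 X) f, r := f, retract := Projective.factorThru_comp _ _ }
    exact (r.map (forget₂ (FGModuleCat R) (ModuleCat R))).projective

theorem ModuleCat.exists_projectiveResolution_finite (X : ModuleCat.{u} R) [Module.Finite R X] :
    ∃ P : ProjectiveResolution X, ∀ n, Module.Finite R (P.complex.X n) :=
  ⟨(forget₂ (FGModuleCat R) (ModuleCat R)).mapProjectiveResolution
    (ProjectiveResolution.of (FGModuleCat.of R X)), fun n ↦
      ((ProjectiveResolution.of (FGModuleCat.of R X)).complex.X n).property⟩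

end

section
variable {R : Type u} [CommRing R] (S : Submonoid R)

/-- The canonical map `R ⧸ I → S⁻¹R ⧸ J` when `J = S⁻¹I`. -/
noncomputable def Ideal.quotientLocalizationMap (I : Ideal R) (J : Ideal (Localization S))
    (h : J = I.map (algebraMap R (Localization S))) : (R ⧸ I) →ₗ[R] (Localization S ⧸ J) :=
  Submodule.mapQ I (J.restrictScalars R) (Algebra.linearMap R (Localization S)) (by
    subst h; exact Ideal.le_comap_map (f := algebraMap R (Localization S)))

theorem Ideal.isLocalizedModule_quotientLocalizationMap (I : Ideal R) (J : Ideal (Localization S))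
    (h : J = I.map (algebraMap R (Localization S))) :
    IsLocalizedModule S (I.quotientLocalizationMap S J h) := by
  obtain rfl : I.localized' (Localization S) S (Algebra.linearMap R (Localization S)) = J := by
    rw [h]
    exact Ideal.localized'_eq_map _ _ _
  exact IsLocalizedModule.toLocalizedQuotient' (Localization S) S
    (Algebra.linearMap R (Localization S)) I

end

section
variable {R : Type u} [CommRing R] (S : Submonoid R)
open localCohomology

/-- The isomorphism `S⁻¹(R ⧸ I) ≅ S⁻¹R ⧸ J` when `J = S⁻¹I`. -/
noncomputable def Ideal.localizedQuotientIso (I : Ideal R) (J : Ideal (Localization S))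
    (h : J = I.map (algebraMap R (Localization S))) :
    (ModuleCat.of R (R ⧸ I)).localizedModule S ≅
      ModuleCat.of (Localization S) (Localization S ⧸ J) :=
  haveI := I.isLocalizedModule_quotientLocalizationMap S J h
  haveI := ModuleCat.localizedModule_isLocalizedModule (ModuleCat.of R (R ⧸ I)) S
  LinearEquiv.toModuleIso
    ((IsLocalizedModule.linearEquiv S ((ModuleCat.of R (R ⧸ I)).localizedModuleMkLinearMap S)
        (I.quotientLocalizationMap S J h)).extendScalarsOfIsLocalization S (Localization S))

theorem Ideal.localizedQuotientIso_hom_apply (I : Ideal R) (J : Ideal (Localization S))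
    (h : J = I.map (algebraMap R (Localization S))) (x : R ⧸ I) :
    (I.localizedQuotientIso S J h).hom ((ModuleCat.of R (R ⧸ I)).localizedModuleMkLinearMap S x) =
      I.quotientLocalizationMap S J h x :=
  haveI := I.isLocalizedModule_quotientLocalizationMap S J h
  haveI := ModuleCat.localizedModule_isLocalizedModule (ModuleCat.of R (R ⧸ I)) S
  IsLocalizedModule.linearEquiv_apply S ((ModuleCat.of R (R ⧸ I)).localizedModuleMkLinearMap S)
    (I.quotientLocalizationMap S J h) x

theorem ModuleCat.localizedModule_hom_ext {M : ModuleCat.{u} R} {N : ModuleCat.{u} (Localization S)}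
    {f g : M.localizedModule S ⟶ N}
    (h : ∀ x, f (M.localizedModuleMkLinearMap S x) = g (M.localizedModuleMkLinearMap S x)) :
    f = g := by
  ext y
  obtain ⟨⟨x, s⟩, hx⟩ := IsLocalizedModule.surj S (M.localizedModuleMkLinearMap S) y
  have hu : IsUnit (algebraMap R (Localization S) s) := IsLocalization.map_units _ s
  have hx' : algebraMap R (Localization S) s • y = M.localizedModuleMkLinearMap S x :=
    (algebraMap_smul (Localization S) (s : R) y).trans hx
  refine hu.smul_left_cancel.1 ?_
  rw [← map_smul, ← map_smul, hx']
  exact h x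

/-- The isomorphism `S⁻¹(R ⧸ I) ≅ S⁻¹R ⧸ S⁻¹I`, natural in `I`. -/
noncomputable def localCohomology.ringModIdealsLocalizedIso {D : Type*} [SmallCategory D]
    (I : D ⥤ Ideal R) (J : D ⥤ Ideal (Localization S))
    (h : ∀ d, J.obj d = (I.obj d).map (algebraMap R (Localization S))) :
    ringModIdeals I ⋙ ModuleCat.localizedModuleFunctor.{u} S ≅ ringModIdeals J :=
  NatIso.ofComponents (fun d ↦ (I.obj d).localizedQuotientIso S (J.obj d) (h d))
    fun {d e} f ↦ by
      apply ModuleCat.localizedModule_hom_ext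
      intro x
      obtain ⟨x, rfl⟩ := Ideal.Quotient.mk_surjective x
      refine (congrArg ((I.obj e).localizedQuotientIso S (J.obj e) (h e)).hom
        (IsLocalizedModule.map_apply S (((ringModIdeals I).obj d).localizedModuleMkLinearMap S)
          (((ringModIdeals I).obj e).localizedModuleMkLinearMap S)
          ((ringModIdeals I).map f).hom _)).trans ?_
      refine (Ideal.localizedQuotientIso_hom_apply S _ _ (h e) _).trans ?_
      refine Eq.trans ?_ (congrArg ((ringModIdeals J).map f)
        (Ideal.localizedQuotientIso_hom_apply S _ _ (h d) _)).symm
      rfl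

end

section
variable {R : Type u} [CommRing R] [IsNoetherianRing R] (S : Submonoid R) (N : ModuleCat.{u} R)
open localCohomology

/-- The maps `Ext(R ⧸ I, N) → Ext(S⁻¹R ⧸ S⁻¹I, S⁻¹N)` induced by localization, natural in `I`. -/
noncomputable def localCohomology.diagramLocalizedHom {D : Type*} [SmallCategory D]
    (I : D ⥤ Ideal R) (J : D ⥤ Ideal (Localization S))
    (h : ∀ d, J.obj d = (I.obj d).map (algebraMap R (Localization S))) (i : ℕ) :
    diagram I i ⋙ (evaluation _ _).obj N ⟶
      (diagram J i ⋙ (evaluation _ _).obj ((ModuleCat.localizedModuleFunctor.{u} S).obj N)) ⋙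
        ModuleCat.restrictScalars.{u} (algebraMap R (Localization S)) :=
  NatTrans.leftOp (F := ringModIdeals J ⋙
      ((linearYoneda (Localization S) _).obj
        ((ModuleCat.localizedModuleFunctor.{u} S).obj N)).rightOp.leftDerived i ⋙
        (ModuleCat.restrictScalars.{u} (algebraMap R (Localization S))).op)
    (G := ringModIdeals I ⋙ ((linearYoneda R (ModuleCat.{u} R)).obj N).rightOp.leftDerived i)
    (Functor.whiskerRight (ringModIdealsLocalizedIso S I J h).inv _ ≫
      Functor.whiskerLeft (ringModIdeals I) (ModuleCat.leftDerivedLocalizedHom S N i))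

theorem localCohomology.exists_smul_mem_range_diagramLocalizedHom {D : Type*} [SmallCategory D]
    (I : D ⥤ Ideal R) (J : D ⥤ Ideal (Localization S))
    (h : ∀ d, J.obj d = (I.obj d).map (algebraMap R (Localization S))) (i : ℕ) (d : Dᵒᵖ)
    (e : ((diagram J i ⋙ (evaluation _ _).obj ((ModuleCat.localizedModuleFunctor.{u} S).obj N)) ⋙
        ModuleCat.restrictScalars.{u} (algebraMap R (Localization S))).obj d) :
    ∃ s : S, (s : R) • e ∈ LinearMap.range ((diagramLocalizedHom S N I J h i).app d).hom := by
  obtain ⟨P, hP⟩ := ModuleCat.exists_projectiveResolution_finite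
    (ModuleCat.of R (R ⧸ I.obj d.unop))
  have := ModuleCat.exists_smul_mem_range_unop_of_isIso S
    ((((linearYoneda (Localization S) _).obj
        ((ModuleCat.localizedModuleFunctor.{u} S).obj N)).rightOp.leftDerived i ⋙
        (ModuleCat.restrictScalars.{u} (algebraMap R (Localization S))).op).map
      ((ringModIdealsLocalizedIso S I J h).inv.app d.unop)) _ (𝟙 _)
    (ModuleCat.exists_smul_mem_range_leftDerivedLocalizedHom S N i P hP) e
  rw [Category.comp_id] at this
  exact this

theorem localCohomology.exists_localizedHom (𝔞 : Ideal R) (i : ℕ) :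
    ∃ φ : (localCohomology 𝔞 i).obj N ⟶
        (ModuleCat.restrictScalars.{u} (algebraMap R (Localization S))).obj
          ((localCohomology (𝔞.map (algebraMap R (Localization S))) i).obj
            ((ModuleCat.localizedModuleFunctor.{u} S).obj N)),
      ∀ e, ∃ s : S, (s : R) • e ∈ LinearMap.range φ.hom := by
  let 𝔟 := 𝔞.map (algebraMap R (Localization S))
  let N' := (ModuleCat.localizedModuleFunctor.{u} S).obj N
  let res := ModuleCat.restrictScalars.{u} (algebraMap R (Localization S))
  have h : ∀ d, (idealPowersDiagram 𝔟).obj d =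
      ((idealPowersDiagram 𝔞).obj d).map (algebraMap R (Localization S)) :=
    fun d ↦ (Ideal.map_pow _ _ _).symm
  have := hasColimitDiagram.{u, 0} (idealPowersDiagram 𝔞) i
  have := hasColimitDiagram.{u, 0} (idealPowersDiagram 𝔟) i
  let c := ((evaluation _ _).obj N).mapCocone (colimit.cocone (diagram (idealPowersDiagram 𝔞) i))
  let c' := ((evaluation _ _).obj N').mapCocone (colimit.cocone (diagram (idealPowersDiagram 𝔟) i))
  have hc : IsColimit c := isColimitOfPreserves _ (colimit.isColimit _)
  have hc' : IsColimit c' := isColimitOfPreserves _ (colimit.isColimit _)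
  let η := diagramLocalizedHom S N (idealPowersDiagram 𝔞) (idealPowersDiagram 𝔟) h i
  refine ⟨hc.desc ((Cocone.precompose η).obj (res.mapCocone c')), fun e ↦ ?_⟩
  have := preservesFilteredColimitsOfSize_shrink.{0, u, 0, u}
    (forget (ModuleCat.{u} (Localization S)))
  obtain ⟨d, x, rfl⟩ := Concrete.isColimit_exists_rep _ hc' e
  obtain ⟨s, y, hy⟩ := exists_smul_mem_range_diagramLocalizedHom S N (idealPowersDiagram 𝔞)
    (idealPowersDiagram 𝔟) h i d x
  refine ⟨s, c.ι.app d y, ?_⟩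
  refine (ConcreteCategory.congr_hom
    (hc.fac ((Cocone.precompose η).obj (res.mapCocone c')) d) y).trans ?_
  refine (congrArg ((res.map (c'.ι.app d))) hy).trans ?_
  exact map_smul (res.map (c'.ι.app d)).hom (s : R) _

theorem localCohomology.isArtinian_localizedModuleFunctor (𝔞 : Ideal R) (i : ℕ)
    [IsArtinian R ((localCohomology 𝔞 i).obj N)] :
    IsArtinian (Localization S) ((localCohomology (𝔞.map (algebraMap R (Localization S))) i).obj
      ((ModuleCat.localizedModuleFunctor.{u} S).obj N)) := by
  obtain ⟨φ, hφ⟩ := exists_localizedHom S N 𝔞 i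
  let H := (localCohomology (𝔞.map (algebraMap R (Localization S))) i).obj
      ((ModuleCat.localizedModuleFunctor.{u} S).obj N)
  let : Module R H := Module.compHom H (algebraMap R (Localization S))
  have : IsScalarTower R (Localization S) H :=
    ⟨fun r x y ↦ by rw [Algebra.smul_def, mul_smul]; rfl⟩
  have hsurj : Function.Surjective φ.hom :=
    φ.hom.surjective_of_isArtinian_of_exists_smul_mem_range (S := S) (fun s x y hxy ↦
      (IsLocalization.map_units (Localization S) s).smul_left_cancel.1 hxy) hφ
  have : IsArtinian R H := isArtinian_of_surjective _ φ.hom hsurj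
  exact isArtinian_of_tower R this

end

end

theorem artinianness_dim_localization_le
    {R : Type u} [CommRing R] [IsNoetherianRing R]
    (𝔞 : Ideal R) (N : Type u) [AddCommGroup N] [Module R N] [Module.Finite R N]
    (S : Submonoid R) (t : ℕ)
    (h_art : ∀ i, t < i → IsArtinian R ((localCohomology 𝔞 i).obj (ModuleCat.of R N))) :
    ∀ i, t < i → IsArtinian (Localization S)
      ((localCohomology (𝔞.map (algebraMap R (Localization S))) i).obj
        (ModuleCat.of (Localization S) (LocalizedModule S N))) := by
  intro i hi
  have := h_art i hi
  have := localCohomology.isArtinian_localizedModuleFunctor S (ModuleCat.of R N) 𝔞 i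
  let e : (ModuleCat.localizedModuleFunctor.{u} S).obj (ModuleCat.of R N) ≅
      ModuleCat.of (Localization S) (LocalizedModule S N) :=
    (Shrink.linearEquiv (Localization S) (LocalizedModule S N)).toModuleIso
  exact isArtinian_of_linearEquiv ((localCohomology _ i).mapIso e).toLinearEquiv
end
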